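/- Let f : ℝⁿ × ℝᵐ → ℝⁿ, U ⊆ ℝᵐ, X_f ⊆ ℝⁿ, and k : ℝⁿ → ℝᵐ satisfy: for every x ∈ X_f, k(x) ∈ U and f(x, k(x)) ∈ X_f. Let l : ℝⁿ × ℝᵐ → ℝ be a nonnegative stage cost and V_f : ℝⁿ → ℝ a nonnegative terminal cost satisfying the terminal decrease condition V_f(f(x, k(x))) ≤ V_f(x) − l(x, k(x)) for every x ∈ X_f. For a horizon N ≥ 1 and a control sequence u = (u_0,…,u_{N−1}) feasible from x (i.e. u_i ∈ U for all i and the trajectory x_0 = x, x_{i+1} = f(x_i, u_i) satisfies x_N ∈ X_f), define the cost J_N(x, u) = ∑_{i=0}^{N−1} l(x_i, u_i) + V_f(x_N), and let J*(x) be the infimum of J_N(x, u) over all feasible u. If u* = (u*_0,…,u*_{N−1}) is feasible from x and attains J*(x), then the successor state x⁺ = f(x, u*_0) admits a feasible sequence and J*(x⁺) ≤ J*(x) − l(x, u*_0). -/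

import Mathlib

/-- The trajectory of the discrete-time controlled system `x_{i+1} = f (x_i) (u_i)`
starting from `x` under the control sequence `u`. -/
def traj {n m : ℕ} (f : (Fin n → ℝ) → (Fin m → ℝ) → (Fin n → ℝ))
    (x : Fin n → ℝ) (u : ℕ → Fin m → ℝ) : ℕ → Fin n → ℝ
  | 0 => x
  | i + 1 => f (traj f x u i) (u i)

/-- A horizon-`N` control sequence `u` is feasible from `x` if all its controls lie in
`U` and the resulting state after `N` steps lies in the terminal set `Xf`. -/
def Feasible {n m : ℕ} (f : (Fin n → ℝ) → (Fin m → ℝ) → (Fin n → ℝ))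
    (U : Set (Fin m → ℝ)) (Xf : Set (Fin n → ℝ)) (N : ℕ)
    (x : Fin n → ℝ) (u : ℕ → Fin m → ℝ) : Prop :=
  (∀ i < N, u i ∈ U) ∧ traj f x u N ∈ Xf

/-- The finite-horizon cost `J_N(x, u) = ∑_{i<N} l(x_i, u_i) + V_f(x_N)`. -/
def costJ {n m : ℕ} (f : (Fin n → ℝ) → (Fin m → ℝ) → (Fin n → ℝ))
    (l : (Fin n → ℝ) → (Fin m → ℝ) → ℝ) (Vf : (Fin n → ℝ) → ℝ) (N : ℕ)
    (x : Fin n → ℝ) (u : ℕ → Fin m → ℝ) : ℝ :=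
  (∑ i ∈ Finset.range N, l (traj f x u i) (u i)) + Vf (traj f x u N)

/-- The MPC optimal value function `J*(x)`: the infimum of `J_N(x, u)` over feasible
control sequences `u`. -/
noncomputable def Jstar {n m : ℕ} (f : (Fin n → ℝ) → (Fin m → ℝ) → (Fin n → ℝ))
    (U : Set (Fin m → ℝ)) (Xf : Set (Fin n → ℝ))
    (l : (Fin n → ℝ) → (Fin m → ℝ) → ℝ) (Vf : (Fin n → ℝ) → ℝ) (N : ℕ)
    (x : Fin n → ℝ) : ℝ :=
  sInf {c : ℝ | ∃ u : ℕ → Fin m → ℝ, Feasible f U Xf N x u ∧ costJ f l Vf N x u = c}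

theorem traj_congr {n m : ℕ} (f : (Fin n → ℝ) → (Fin m → ℝ) → (Fin n → ℝ))
    (x : Fin n → ℝ) {u v : ℕ → Fin m → ℝ} {N : ℕ} (h : ∀ i < N, u i = v i) :
    traj f x u N = traj f x v N := by
  induction N with
  | zero => rfl
  | succ N ih =>
    simp only [traj, ih fun i hi => h i (hi.trans N.lt_succ_self), h N N.lt_succ_self]

theorem traj_shift {n m : ℕ} (f : (Fin n → ℝ) → (Fin m → ℝ) → (Fin n → ℝ))
    (x : Fin n → ℝ) (u : ℕ → Fin m → ℝ) (N : ℕ) :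
    traj f (f x (u 0)) (fun i => u (i + 1)) N = traj f x u (N + 1) := by
  induction N with
  | zero => rfl
  | succ N ih => rw [traj, ih, traj.eq_2 f x u (N + 1)]

theorem traj_update {n m : ℕ} (f : (Fin n → ℝ) → (Fin m → ℝ) → (Fin n → ℝ))
    (x : Fin n → ℝ) (u : ℕ → Fin m → ℝ) (a : Fin m → ℝ) {i N : ℕ} (hi : i ≤ N) :
    traj f x (Function.update u N a) i = traj f x u i :=
  traj_congr f x fun _ hj => Function.update_of_ne (hj.trans_le hi).ne _ _

theorem Feasible.shift {n m : ℕ} {f : (Fin n → ℝ) → (Fin m → ℝ) → (Fin n → ℝ)}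
    {U : Set (Fin m → ℝ)} {Xf : Set (Fin n → ℝ)} {N : ℕ}
    {x : Fin n → ℝ} {u : ℕ → Fin m → ℝ} (h : Feasible f U Xf (N + 1) x u) :
    Feasible f U Xf N (f x (u 0)) fun i => u (i + 1) :=
  ⟨fun i hi => h.1 (i + 1) (Nat.succ_lt_succ hi), by rw [traj_shift]; exact h.2⟩

/-- Appending an admissible control that keeps the terminal state in `Xf` preserves
feasibility. -/
theorem Feasible.update {n m : ℕ} {f : (Fin n → ℝ) → (Fin m → ℝ) → (Fin n → ℝ)}
    {U : Set (Fin m → ℝ)} {Xf : Set (Fin n → ℝ)} {N : ℕ}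
    {x : Fin n → ℝ} {u : ℕ → Fin m → ℝ} (h : Feasible f U Xf N x u)
    {a : Fin m → ℝ} (ha : a ∈ U) (hfa : f (traj f x u N) a ∈ Xf) :
    Feasible f U Xf (N + 1) x (Function.update u N a) := by
  refine ⟨fun i hi => ?_, ?_⟩
  · rcases Nat.lt_succ_iff_lt_or_eq.mp hi with hi | rfl
    · rw [Function.update_of_ne hi.ne]
      exact h.1 i hi
    · rwa [Function.update_self]
  · rwa [traj, traj_update f x u a le_rfl, Function.update_self]

theorem costJ_succ_eq_add_shift {n m : ℕ} (f : (Fin n → ℝ) → (Fin m → ℝ) → (Fin n → ℝ))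
    (l : (Fin n → ℝ) → (Fin m → ℝ) → ℝ) (Vf : (Fin n → ℝ) → ℝ) (N : ℕ)
    (x : Fin n → ℝ) (u : ℕ → Fin m → ℝ) :
    costJ f l Vf (N + 1) x u =
      l x (u 0) + costJ f l Vf N (f x (u 0)) fun i => u (i + 1) := by
  simp only [costJ, traj_shift, Finset.sum_range_succ', traj.eq_1]
  ring

theorem costJ_update {n m : ℕ} (f : (Fin n → ℝ) → (Fin m → ℝ) → (Fin n → ℝ))
    (l : (Fin n → ℝ) → (Fin m → ℝ) → ℝ) (Vf : (Fin n → ℝ) → ℝ) (N : ℕ)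
    (x : Fin n → ℝ) (u : ℕ → Fin m → ℝ) (a : Fin m → ℝ) :
    costJ f l Vf (N + 1) x (Function.update u N a) =
      costJ f l Vf N x u - Vf (traj f x u N) + l (traj f x u N) a +
        Vf (f (traj f x u N) a) := by
  have hsum : ∑ i ∈ Finset.range N, l (traj f x (Function.update u N a) i)
      (Function.update u N a i) = ∑ i ∈ Finset.range N, l (traj f x u i) (u i) := by
    refine Finset.sum_congr rfl fun i hi => ?_
    have hi := Finset.mem_range.mp hi
    rw [traj_update f x u a hi.le, Function.update_of_ne hi.ne]
  rw [costJ, costJ, Finset.sum_range_succ, hsum, traj, traj_update f x u a le_rfl,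
    Function.update_self]
  ring

theorem costJ_nonneg {n m : ℕ} (f : (Fin n → ℝ) → (Fin m → ℝ) → (Fin n → ℝ))
    {l : (Fin n → ℝ) → (Fin m → ℝ) → ℝ} {Vf : (Fin n → ℝ) → ℝ}
    (hl : ∀ x u, 0 ≤ l x u) (hVf : ∀ x, 0 ≤ Vf x) (N : ℕ)
    (x : Fin n → ℝ) (u : ℕ → Fin m → ℝ) : 0 ≤ costJ f l Vf N x u :=
  add_nonneg (Finset.sum_nonneg fun _ _ => hl _ _) (hVf _)

theorem Jstar_le_costJ {n m : ℕ} {f : (Fin n → ℝ) → (Fin m → ℝ) → (Fin n → ℝ)}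
    {U : Set (Fin m → ℝ)} {Xf : Set (Fin n → ℝ)}
    {l : (Fin n → ℝ) → (Fin m → ℝ) → ℝ} {Vf : (Fin n → ℝ) → ℝ}
    (hl : ∀ x u, 0 ≤ l x u) (hVf : ∀ x, 0 ≤ Vf x) {N : ℕ}
    {x : Fin n → ℝ} {u : ℕ → Fin m → ℝ} (h : Feasible f U Xf N x u) :
    Jstar f U Xf l Vf N x ≤ costJ f l Vf N x u := by
  refine csInf_le ⟨0, ?_⟩ ⟨u, h, rfl⟩
  rintro _ ⟨v, -, rfl⟩
  exact costJ_nonneg f hl hVf N x v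

/-- MPC value-function decrease: under positive invariance of `Xf` under the auxiliary
law `k` (with values in `U`), nonnegative stage cost `l`, nonnegative terminal cost `Vf`
satisfying the terminal decrease condition on `Xf`, if `u*` is feasible from `x` over
horizon `N ≥ 1` and attains `J*(x)`, then the successor state `x⁺ = f x (u*_0)` admits a
feasible sequence and `J*(x⁺) ≤ J*(x) − l(x, u*_0)`. -/
theorem Jstar_decrease {n m : ℕ}
    (f : (Fin n → ℝ) → (Fin m → ℝ) → (Fin n → ℝ))
    (U : Set (Fin m → ℝ)) (Xf : Set (Fin n → ℝ)) (k : (Fin n → ℝ) → (Fin m → ℝ))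
    (l : (Fin n → ℝ) → (Fin m → ℝ) → ℝ) (Vf : (Fin n → ℝ) → ℝ)
    (hk : ∀ x ∈ Xf, k x ∈ U ∧ f x (k x) ∈ Xf)
    (hl : ∀ x u, 0 ≤ l x u) (hVf : ∀ x, 0 ≤ Vf x)
    (hdec : ∀ x ∈ Xf, Vf (f x (k x)) ≤ Vf x - l x (k x))
    (N : ℕ) (hN : 1 ≤ N)
    (x : Fin n → ℝ) (ustar : ℕ → Fin m → ℝ)
    (hfeas : Feasible f U Xf N x ustar)
    (hopt : costJ f l Vf N x ustar = Jstar f U Xf l Vf N x) :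
    (∃ v : ℕ → Fin m → ℝ, Feasible f U Xf N (f x (ustar 0)) v) ∧
    Jstar f U Xf l Vf N (f x (ustar 0)) ≤ Jstar f U Xf l Vf N x - l x (ustar 0) := by
  obtain ⟨hkU, hkXf⟩ := hk _ hfeas.2
  set a := k (traj f x ustar N) with ha
  have h0 : Function.update ustar N a 0 = ustar 0 :=
    Function.update_of_ne (Nat.pos_iff_ne_zero.mp hN).symm _ _
  have hshift := (hfeas.update hkU hkXf).shift
  have hcost := costJ_succ_eq_add_shift f l Vf N x (Function.update ustar N a)
  rw [h0] at hshift hcost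
  refine ⟨⟨_, hshift⟩, ?_⟩
  have hle := Jstar_le_costJ hl hVf hshift
  have hupd := costJ_update f l Vf N x ustar a
  have hterm := hdec _ hfeas.2
  rw [← ha] at hterm
  linarith
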